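/- arXiv:2512.19345 — 3 statements merged into one kernel-verified Lean document; each statement's English description precedes it below -/
import Mathlib

section
/- Let p be an odd prime, let G be a non-Abelian finite p-group, and let m be the largest non-negative integer such that some non-linear irreducible complex character of G has kernel of order p^m. Then the nilpotency class of G is at most m + 2. -/
open CategoryTheory

/-- The kernel of the character of a complex representation `V` of `G`:
`ker χ = {g ∈ G : χ(g) = χ(1)}`. -/
noncomputable def charKer {G : Type} [Group G] (V : FDRep ℂ G) : Set G :=
  {g | V.character g = V.character 1}

/-- The center of the character of a complex representation `V` of `G`:
`Z(χ) = {g ∈ G : |χ(g)| = χ(1)}`. -/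
noncomputable def charCenter {G : Type} [Group G] (V : FDRep ℂ G) : Set G :=
  {g | (‖V.character g‖ : ℂ) = V.character 1}

open scoped ComplexOrder in
theorem Multiset.eq_one_of_sum_eq_card {s : Multiset ℂ} (hs : ∀ z ∈ s, ‖z‖ = 1)
    (hsum : s.sum = s.card) : ∀ z ∈ s, z = 1 := by
  have hre : (s.map fun z : ℂ => 1 - z.re).sum = 0 := by
    have h := congrArg Complex.re hsum
    have h2 : s.sum.re = (s.map Complex.re).sum := map_multiset_sum Complex.reAddGroupHom s
    simp only [Multiset.sum_map_sub, Multiset.map_const', Multiset.sum_replicate, nsmul_eq_mul,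
      mul_one, ← h2, h, Complex.natCast_re, sub_self]
  have hnn : ∀ x ∈ s.map fun z : ℂ => 1 - z.re, 0 ≤ x := by
    simp only [Multiset.mem_map]
    rintro x ⟨z, hz, rfl⟩
    have := Complex.re_le_norm z
    rw [hs z hz] at this
    linarith
  intro z hz
  have h0 := Multiset.all_zero_of_le_zero_le_of_sum_eq_zero hnn hre _
    (Multiset.mem_map_of_mem _ hz)
  have hre1 : z.re = 1 := (sub_eq_zero.1 h0).symm
  have hnonneg : 0 ≤ z := Complex.re_eq_norm.1 (hre1.trans (hs z hz).symm)
  rw [Complex.eq_re_of_ofReal_le hnonneg, hre1, Complex.ofReal_one]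

theorem Module.End.eq_one_of_pow_eq_one_of_trace_eq {V : Type*} [AddCommGroup V] [Module ℂ V]
    [FiniteDimensional ℂ V] {f : Module.End ℂ V} {n : ℕ} (hn : n ≠ 0) (hf : f ^ n = 1)
    (htr : LinearMap.trace ℂ V f = Module.finrank ℂ V) : f = 1 := by
  have hroots : ∀ z ∈ f.charpoly.roots, z = 1 := by
    apply Multiset.eq_one_of_sum_eq_card
    · intro z hz
      have hz' : f.HasEigenvalue z := by
        rw [Module.End.hasEigenvalue_iff_isRoot_charpoly]
        exact (Polynomial.mem_roots'.1 hz).2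
      obtain ⟨v, hv⟩ := hz'.exists_hasEigenvector
      have h1 := hv.pow_apply n
      rw [hf, Module.End.one_apply] at h1
      have h2 : z ^ n = 1 := smul_left_injective ℂ hv.2 (by simpa using h1.symm)
      exact Complex.norm_eq_one_of_pow_eq_one h2 hn
    · rw [← Module.End.trace_eq_sum_roots_charpoly_of_splits (IsAlgClosed.splits _), htr,
        ← (IsAlgClosed.splits f.charpoly).natDegree_eq_card_roots, LinearMap.charpoly_natDegree]
  have hchar : f.charpoly = (Polynomial.X - Polynomial.C 1) ^ Module.finrank ℂ V := by
    have := (IsAlgClosed.splits f.charpoly).eq_prod_roots_of_monic f.charpoly_monic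
    rw [this, Multiset.eq_replicate_of_mem hroots,
      ← (IsAlgClosed.splits f.charpoly).natDegree_eq_card_roots, LinearMap.charpoly_natDegree]
    simp
  have hnil : IsNilpotent (f - 1) := by
    refine ⟨Module.finrank ℂ V, ?_⟩
    have := f.aeval_self_charpoly
    rw [hchar] at this
    simpa using this
  have hss : (f - 1).IsSemisimple := by
    have hsq : f.IsSemisimple := by
      refine Module.End.isSemisimple_of_squarefree_aeval_eq_zero
        (p := Polynomial.X ^ n - Polynomial.C 1) ?_ (by simp [hf])
      exact ((Polynomial.separable_X_pow_sub_C (1 : ℂ) (by exact_mod_cast hn)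
        one_ne_zero)).squarefree
    have := hsq.aeval (Polynomial.X - Polynomial.C 1)
    simpa using this
  exact sub_eq_zero.1 (Module.End.eq_zero_of_isNilpotent_isSemisimple hnil hss)

theorem charKer_eq_ker {G : Type} [Group G] [Finite G] (V : FDRep ℂ G) :
    charKer V = (MonoidHom.ker V.ρ : Set G) := by
  ext g
  simp only [charKer, Set.mem_ofPred_eq, SetLike.mem_coe, MonoidHom.mem_ker]
  refine ⟨fun h => ?_, fun h => ?_⟩
  · refine Module.End.eq_one_of_pow_eq_one_of_trace_eq (orderOf_pos g).ne' ?_ ?_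
    · rw [← map_pow, pow_orderOf_eq_one, map_one]
    · rw [← FDRep.char_one, ← h, FDRep.character]
  · simp only [FDRep.character, h, map_one]

theorem Subrepresentation.isIrreducible_toRepresentation {k G V : Type*} [Field k] [Group G]
    [AddCommGroup V] [Module k V] {ρ : Representation k G V} {σ : Subrepresentation ρ}
    (hσ : IsAtom σ) : σ.toRepresentation.IsIrreducible := by
  have push : ∀ τ : Subrepresentation σ.toRepresentation, τ = ⊥ ∨ τ = ⊤ := by
    intro τ
    let τ' : Subrepresentation ρ :=
      { toSubmodule := τ.toSubmodule.map σ.toSubmodule.subtype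
        apply_mem_toSubmodule := by
          rintro g _ ⟨w, hw, rfl⟩
          exact ⟨σ.toRepresentation g w, τ.apply_mem_toSubmodule g hw, rfl⟩ }
    have hle : τ' ≤ σ := by
      rintro _ ⟨w, -, rfl⟩
      exact w.2
    rcases hσ.le_iff.1 hle with h | h
    · left
      apply Subrepresentation.toSubmodule_injective
      have h' : τ.toSubmodule.map σ.toSubmodule.subtype = ⊥ :=
        congrArg Subrepresentation.toSubmodule h
      apply Submodule.map_injective_of_injective σ.toSubmodule.injective_subtype
      rw [h']
      exact (Submodule.map_bot _).symm
    · right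
      apply Subrepresentation.toSubmodule_injective
      have h' : τ.toSubmodule.map σ.toSubmodule.subtype = σ.toSubmodule :=
        congrArg Subrepresentation.toSubmodule h
      apply Submodule.map_injective_of_injective σ.toSubmodule.injective_subtype
      rw [h']
      exact (Submodule.map_subtype_top _).symm
  refine { exists_pair_ne := ⟨⊥, ⊤, fun h => hσ.1 ?_⟩, eq_bot_or_eq_top := push }
  apply Subrepresentation.toSubmodule_injective
  have h' : (⊥ : Submodule k σ.toSubmodule) = ⊤ := congrArg Subrepresentation.toSubmodule h
  exact Submodule.subsingleton_iff_eq_bot.1 ((Submodule.subsingleton_iff k).1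
    (subsingleton_iff_bot_eq_top.1 h'))

theorem Representation.exists_isAtom_of_commutator_apply_ne {k G V : Type*} [Field k] [Group G]
    [Finite G] [NeZero (Nat.card G : k)] [AddCommGroup V] [Module k V] [FiniteDimensional k V]
    (ρ : Representation k G V) {a b : G} {v : V}
    (hv : ρ (a * b) v ≠ ρ (b * a) v) :
    ∃ σ : Subrepresentation ρ, IsAtom σ ∧ 1 < Module.finrank k σ.toSubmodule := by
  by_contra! hcon
  apply hv
  have hmem : (show ρ.asModule from v) ∈
      sSup {S : Submodule (MonoidAlgebra k G) ρ.asModule |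
        IsSimpleModule (MonoidAlgebra k G) S} := by
    rw [IsSemisimpleModule.sSup_simples_eq_top]
    trivial
  rw [sSup_eq_iSup'] at hmem
  refine Submodule.iSup_induction _ (motive := fun w : ρ.asModule => ρ (a * b) (show V from w) =
    ρ (b * a) (show V from w)) hmem ?_ ?_ ?_
  · rintro ⟨S, hS⟩ w hw
    have hat : IsAtom (Subrepresentation.subrepresentationSubmoduleOrderIso.symm S) :=
      (OrderIso.isAtom_iff _ _).2 (isSimpleModule_iff_isAtom.1 hS)
    generalize hσ : Subrepresentation.subrepresentationSubmoduleOrderIso.symm S = σ at hat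
    have hwσ : (show V from w) ∈ σ.toSubmodule := by rw [← hσ]; exact hw
    obtain ⟨u, hu⟩ := finrank_le_one_iff.1 (hcon σ hat)
    obtain ⟨α, hα⟩ := hu (σ.toRepresentation a u)
    obtain ⟨β, hβ⟩ := hu (σ.toRepresentation b u)
    obtain ⟨c, hc⟩ := hu ⟨_, hwσ⟩
    have key : σ.toRepresentation (a * b) ⟨_, hwσ⟩ = σ.toRepresentation (b * a) ⟨_, hwσ⟩ := by
      rw [← hc]
      simp only [map_mul, Module.End.mul_apply, map_smul, ← hα, ← hβ, smul_comm α β]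
    exact congrArg Subtype.val key
  · exact (map_zero (ρ (a * b))).trans (map_zero (ρ (b * a))).symm
  · intro x y hx hy
    exact (map_add (ρ (a * b)) _ _).trans ((congrArg₂ _ hx hy).trans (map_add (ρ (b * a)) _ _).symm)

theorem FDRep.simple_of_isIrreducible {G V : Type} [Group G] [Finite G] [AddCommGroup V]
    [Module ℂ V] [FiniteDimensional ℂ V] (ρ : Representation ℂ G V) [ρ.IsIrreducible] :
    Simple (FDRep.of ρ) := by
  have := Fintype.ofFinite G
  have : Invertible (Nat.card G : ℂ) := invertibleOfNonzero (by exact_mod_cast Nat.card_pos.ne')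
  rw [FDRep.simple_iff_char_is_norm_one]
  have h := Representation.char_orthonormal ρ ρ
  rw [if_pos ⟨Representation.Equiv.refl ρ⟩, inv_mul_eq_one₀ (Invertible.ne_zero _)] at h
  exact h.symm

theorem Subgroup.exists_simple_le_ker {G : Type} [Group G] [Finite G] (N : Subgroup G) [N.Normal]
    {a b : G} (hab : a * b * a⁻¹ * b⁻¹ ∉ N) :
    ∃ V : FDRep ℂ G, Simple V ∧ 1 < Module.finrank ℂ V ∧ N ≤ MonoidHom.ker V.ρ := by
  have : NeZero (Nat.card G : ℂ) := ⟨by exact_mod_cast Nat.card_pos.ne'⟩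
  let ρ := Representation.ofMulAction ℂ G (G ⧸ N)
  have hN : ∀ g ∈ N, ρ g = 1 := by
    intro g hg
    ext q : 2
    induction q using QuotientGroup.induction_on with | _ x
    have hq : g • (x : G ⧸ N) = x := by
      rw [MulAction.Quotient.smul_coe, QuotientGroup.eq]
      simpa [mul_assoc] using ‹N.Normal›.conj_mem _ (N.inv_mem hg) x⁻¹
    simp [ρ, hq]
  obtain ⟨σ, hσ, hdim⟩ := Representation.exists_isAtom_of_commutator_apply_ne ρ
    (a := b⁻¹) (b := a⁻¹) (v := MonoidAlgebra.single ((1 : G) : G ⧸ N) 1) (by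
      intro h
      rw [Representation.ofMulAction_single, Representation.ofMulAction_single,
        MonoidAlgebra.single_left_inj one_ne_zero, MulAction.Quotient.smul_coe,
        MulAction.Quotient.smul_coe, QuotientGroup.eq] at h
      exact hab (by simpa [mul_assoc] using h))
  have := Subrepresentation.isIrreducible_toRepresentation hσ
  refine ⟨FDRep.of σ.toRepresentation, FDRep.simple_of_isIrreducible _, hdim, fun g hg => ?_⟩
  rw [MonoidHom.mem_ker, FDRep.of_ρ']
  exact LinearMap.ext fun w => Subtype.ext (LinearMap.congr_fun (hN g hg) w.1)

theorem Subgroup.lowerCentralSeries_succ_lt {G : Type*} [Group G] [Group.IsNilpotent G] {i : ℕ}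
    (hi : i < Group.nilpotencyClass G) :
    (⊤ : Subgroup G).lowerCentralSeries (i + 1) < (⊤ : Subgroup G).lowerCentralSeries i := by
  refine lt_of_le_of_ne (Subgroup.lowerCentralSeries_antitone _ i.le_succ) fun h => ?_
  have hstab : ∀ j, (⊤ : Subgroup G).lowerCentralSeries (i + j) =
      (⊤ : Subgroup G).lowerCentralSeries i := by
    intro j
    induction j with
    | zero => rfl
    | succ j ih =>
      rw [← add_assoc, Subgroup.lowerCentralSeries_succ, ih, ← Subgroup.lowerCentralSeries_succ, h]
  refine hi.not_ge (lowerCentralSeries_eq_bot_iff_nilpotencyClass_le.1 ?_)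
  rw [← hstab (Group.nilpotencyClass G)]
  exact lowerCentralSeries_eq_bot_iff_nilpotencyClass_le.2 (Nat.le_add_left _ _)

theorem IsPGroup.pow_le_card_lowerCentralSeries {p : ℕ} [hp : Fact p.Prime] {G : Type*} [Group G]
    [Finite G] [Group.IsNilpotent G] (hG : IsPGroup p G) (j : ℕ) {i : ℕ}
    (h : i + j ≤ Group.nilpotencyClass G) :
    p ^ j ≤ Nat.card ((⊤ : Subgroup G).lowerCentralSeries i) := by
  induction j generalizing i with
  | zero => exact (pow_zero p).trans_le Nat.card_pos
  | succ j ih =>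
    obtain ⟨k, hk⟩ := (hG.to_subgroup (Subgroup.lowerCentralSeries ⊤ i)).exists_card_eq
    have hlt : Nat.card ((⊤ : Subgroup G).lowerCentralSeries (i + 1)) <
        Nat.card ((⊤ : Subgroup G).lowerCentralSeries i) :=
      Set.Finite.card_lt_card (Set.toFinite _)
        (SetLike.coe_ssubset_coe.2 (Subgroup.lowerCentralSeries_succ_lt (by omega)))
    have h := (ih (i := i + 1) (by omega)).trans_lt hlt
    rw [hk] at h ⊢
    exact Nat.pow_le_pow_right hp.out.pos ((Nat.pow_lt_pow_iff_right hp.out.one_lt).1 h)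

/-- If `m` is the largest non-negative integer such that some non-linear irreducible
complex character of the non-Abelian finite `p`-group `G` (`p` odd) has kernel of order
`p ^ m`, then the nilpotency class of `G` is at most `m + 2`. -/
theorem nilpotencyClass_le_of_max_kernel_order (p m : ℕ) (hp : p.Prime) (hodd : Odd p)
    (G : Type) [Group G] [Fintype G] (hpG : IsPGroup p G)
    (hnab : ¬ ∀ a b : G, a * b = b * a)
    (hex : ∃ V : FDRep ℂ G, Simple V ∧ 1 < Module.finrank ℂ V ∧
      Nat.card (charKer V) = p ^ m)
    (hmax : ∀ k : ℕ, (∃ V : FDRep ℂ G, Simple V ∧ 1 < Module.finrank ℂ V ∧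
      Nat.card (charKer V) = p ^ k) → k ≤ m) :
    (letI : Fact p.Prime := ⟨hp⟩; letI := hpG.isNilpotent;
      Group.nilpotencyClass G ≤ m + 2) := by
  have : Fact p.Prime := ⟨hp⟩
  have := hpG.isNilpotent
  change Group.nilpotencyClass G ≤ m + 2
  by_contra! hc
  have hcard := hpG.pow_le_card_lowerCentralSeries (m + 1) (i := 2) (by omega)
  have hlt := Subgroup.lowerCentralSeries_succ_lt (G := G) (i := 1) (by omega)
  obtain ⟨a, b, hab⟩ : ∃ a b : G, a * b * a⁻¹ * b⁻¹ ∉ (⊤ : Subgroup G).lowerCentralSeries 2 := by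
    by_contra! h
    exact hlt.not_ge (Subgroup.commutator_le.2 fun a _ b _ => h a b)
  obtain ⟨V, hV, hdim, hker⟩ := Subgroup.exists_simple_le_ker _ hab
  obtain ⟨k, hk⟩ := (hpG.to_subgroup (MonoidHom.ker V.ρ)).exists_card_eq
  have hkm := hmax k ⟨V, hV, hdim, by rw [charKer_eq_ker]; exact hk⟩
  have h1 := hcard.trans (Subgroup.card_le_of_le hker)
  rw [hk, Nat.pow_le_pow_iff_right hp.one_lt] at h1
  omega
end

section
/- Let p be an odd prime, let G be a non-Abelian finite p-group, and let m be the largest non-negative integer such that some non-linear irreducible complex character of G has kernel of order p^m. If χ is a non-linear irreducible complex character of G with |ker χ| = p^m, then χ(1)^2 = |G| / |Z(χ)|. -/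
open CategoryTheory

theorem Multiset.eq_one_of_norm_le_one_of_sum_eq_card (s : Multiset ℂ)
    (hs : ∀ x ∈ s, ‖x‖ ≤ 1) (hsum : s.sum = s.card) : ∀ x ∈ s, x = 1 := by
  have re_le : ∀ t : Multiset ℂ, (∀ x ∈ t, ‖x‖ ≤ 1) → t.sum.re ≤ t.card := by
    intro t
    induction t using Multiset.induction_on with
    | empty => simp
    | cons a t ih =>
      intro ht
      have h1 := ih fun x hx ↦ ht x (Multiset.mem_cons_of_mem hx)
      have h2 := (Complex.re_le_norm a).trans (ht a (Multiset.mem_cons_self a t))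
      simp only [Multiset.sum_cons, Complex.add_re, Multiset.card_cons, Nat.cast_add, Nat.cast_one]
      linarith
  intro x hx
  obtain ⟨t, rfl⟩ := Multiset.exists_cons_of_mem hx
  have h1 := re_le t fun y hy ↦ hs y (Multiset.mem_cons_of_mem hy)
  have h2 := hs x hx
  have h3 := congrArg Complex.re hsum
  simp only [Multiset.sum_cons, Complex.add_re, Multiset.card_cons, Nat.cast_add, Nat.cast_one,
    Complex.natCast_re, Complex.one_re] at h3
  have h4 := Complex.re_le_norm x
  have h5 : x.re = 1 := by linarith
  have h6 : ‖x‖ ^ 2 ≤ 1 := by nlinarith [norm_nonneg x]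
  rw [Complex.sq_norm, Complex.normSq_apply, h5] at h6
  refine Complex.ext h5 ?_
  simp only [Complex.one_im]
  nlinarith

theorem Module.End.eq_one_of_pow_eq_one_of_trace_eq_finrank {V : Type*} [AddCommGroup V]
    [Module ℂ V] [FiniteDimensional ℂ V] (f : Module.End ℂ V) {k : ℕ} (hk : k ≠ 0)
    (hf : f ^ k = 1) (htr : LinearMap.trace ℂ V f = Module.finrank ℂ V) : f = 1 := by
  have hsplit := IsAlgClosed.splits f.charpoly
  have hcard : f.charpoly.roots.card = Module.finrank ℂ V := by
    rw [← hsplit.natDegree_eq_card_roots, LinearMap.charpoly_natDegree]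
  have hroots : ∀ x ∈ f.charpoly.roots, x = 1 := by
    refine Multiset.eq_one_of_norm_le_one_of_sum_eq_card _ (fun x hx ↦ ?_) ?_
    · have hx' : f.HasEigenvalue x :=
        (Module.End.hasEigenvalue_iff_isRoot_charpoly f x).2 (Polynomial.isRoot_of_mem_roots hx)
      obtain ⟨v, hv⟩ := hx'.exists_hasEigenvector
      have h1 := hv.pow_apply k
      rw [hf, Module.End.one_apply] at h1
      have h2 : (x ^ k - 1) • v = 0 := by rw [sub_smul, ← h1, one_smul, sub_self]
      have h3 : x ^ k = 1 :=
        sub_eq_zero.1 ((smul_eq_zero.1 h2).resolve_right hv.2)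
      exact (Complex.norm_eq_one_of_pow_eq_one h3 hk).le
    · rw [← Module.End.trace_eq_sum_roots_charpoly_of_splits hsplit, htr, hcard]
  have hchar : f.charpoly = (Polynomial.X - Polynomial.C 1) ^ Module.finrank ℂ V := by
    rw [hsplit.eq_prod_roots_of_monic f.charpoly_monic, Multiset.eq_replicate.2 ⟨hcard, hroots⟩]
    simp
  have hsq : Squarefree (minpoly ℂ f) := by
    have hsep : (Polynomial.X ^ k - 1 : Polynomial ℂ).Separable :=
      Polynomial.X_pow_sub_one_separable_iff.2 (by exact_mod_cast hk)
    refine hsep.squarefree.squarefree_of_dvd (minpoly.dvd ℂ f ?_)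
    simp [hf]
  have hdvd : minpoly ℂ f ∣ Polynomial.X - Polynomial.C 1 :=
    hsq.isRadical _ _ (hchar ▸ LinearMap.minpoly_dvd_charpoly f)
  have := (minpoly.dvd_iff).1 hdvd
  simpa [sub_eq_zero] using this

namespace Representation

variable {k G : Type*} [Field k] [Monoid G] (M : Type*) [AddCommGroup M] [Module k M]
  [Module (MonoidAlgebra k G) M] [IsScalarTower k (MonoidAlgebra k G) M]

theorem ofModule'_apply (g : G) (x : M) :
    (ofModule' M : Representation k G M) g x = MonoidAlgebra.of k G g • x := rfl

theorem isIrreducible_ofModule' [IsSimpleModule (MonoidAlgebra k G) M] :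
    (ofModule' M : Representation k G M).IsIrreducible := by
  rw [irreducible_iff_isSimpleModule_asModule]
  have hlsmul : (ofModule' M : Representation k G M).asAlgebraHom = Algebra.lsmul k k M :=
    _root_.Equiv.apply_symm_apply (MonoidAlgebra.lift k (M →ₗ[k] M) G) _
  let e : (ofModule' M : Representation k G M).asModule ≃ₗ[MonoidAlgebra k G] M :=
    { (ofModule' M : Representation k G M).asModuleEquiv.toAddEquiv with
      map_smul' := fun r x ↦ by
        change (ofModule' M : Representation k G M).asModuleEquiv (r • x) = r • _
        rw [asModuleEquiv_map_smul, hlsmul]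
        rfl }
  exact IsSimpleModule.congr e

end Representation

open scoped commutatorElement

namespace FDRep

variable {G : Type} [Group G]

theorem eq_smul_one_of_forall_commute [Finite G] (V : FDRep ℂ G) [Simple V] (f : V →ₗ[ℂ] V)
    (hf : ∀ g, V.ρ g ∘ₗ f = f ∘ₗ V.ρ g) : ∃ c : ℂ, f = c • LinearMap.id := by
  have h1 : Module.finrank ℂ (V ⟶ V) = 1 := finrank_endomorphism_simple_eq_one ℂ V
  rw [← (Representation.linHom.invariantsEquivFDRepHom V V).finrank_eq] at h1
  have mem : ∀ f : V →ₗ[ℂ] V, (∀ g, V.ρ g ∘ₗ f = f ∘ₗ V.ρ g) →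
      f ∈ (Representation.linHom V.ρ V.ρ).invariants := by
    intro f hf g
    rw [Representation.linHom_apply, ← LinearMap.comp_assoc, hf, LinearMap.comp_assoc]
    change f * (V.ρ g * V.ρ g⁻¹) = f
    rw [← map_mul, mul_inv_cancel, map_one, mul_one]
  have hid := mem LinearMap.id fun g ↦ by rw [LinearMap.comp_id, LinearMap.id_comp]
  by_cases h0 : (LinearMap.id : V →ₗ[ℂ] V) = 0
  · exact ⟨0, by rw [zero_smul, ← LinearMap.comp_id f, h0, LinearMap.comp_zero]⟩
  · obtain ⟨c, hc⟩ := (finrank_eq_one_iff_of_nonzero' (⟨LinearMap.id, hid⟩ :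
      (Representation.linHom V.ρ V.ρ).invariants) (fun h ↦ h0 (congrArg Subtype.val h))).1 h1
        ⟨f, mem f hf⟩
    exact ⟨c, (congrArg Subtype.val hc).symm⟩

theorem simple_of_isIrreducible_s4 [Finite G] {W : Type} [AddCommGroup W] [Module ℂ W]
    [FiniteDimensional ℂ W] (σ : Representation ℂ G W) [σ.IsIrreducible] :
    Simple (FDRep.of σ) := by
  rw [simple_iff_end_is_rank_one,
    ← (Representation.linHom.invariantsEquivFDRepHom (of σ) (of σ)).finrank_eq]
  exact (Representation.invariantsEquivIntertwiningMap σ σ).finrank_eq.trans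
    (Representation.IsIrreducible.finrank_intertwiningMap_self σ)

theorem exists_simple_ρ_ne_one [Finite G] {W : Type} [AddCommGroup W] [Module ℂ W]
    (ρ : Representation ℂ G W) (z : G) (hz : ρ z ≠ 1) :
    ∃ U : FDRep ℂ G, Simple U ∧ U.ρ z ≠ 1 ∧ ∀ g, ρ g = 1 → U.ρ g = 1 := by
  obtain ⟨S, hS, v, hv⟩ : ∃ S : Submodule (MonoidAlgebra ℂ G) ρ.asModule,
      IsSimpleModule (MonoidAlgebra ℂ G) S ∧
        ∃ v : S, MonoidAlgebra.of ℂ G z • v ≠ v := by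
    by_contra! hcon
    refine hz (LinearMap.ext fun w ↦ ?_)
    have hw : ρ.asModuleEquiv.symm w ∈
        sSup {S : Submodule (MonoidAlgebra ℂ G) ρ.asModule |
          IsSimpleModule (MonoidAlgebra ℂ G) S} := by
      rw [IsSemisimpleModule.sSup_simples_eq_top]; trivial
    rw [sSup_eq_iSup'] at hw
    have := Submodule.iSup_induction _
      (motive := fun x ↦ MonoidAlgebra.of ℂ G z • x = x) hw
      (fun S x hx ↦ congrArg Subtype.val (hcon S.1 S.2 ⟨x, hx⟩)) (smul_zero _)
      (fun x y hx hy ↦ by rw [smul_add, hx, hy])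
    rw [← Representation.asModuleEquiv_symm_map_rho] at this
    exact ρ.asModuleEquiv.symm.injective this
  have : Module.Finite ℂ S := Module.Finite.trans (MonoidAlgebra ℂ G) _
  let σ : Representation ℂ G S := Representation.ofModule' S
  have hirr : σ.IsIrreducible := Representation.isIrreducible_ofModule' S
  refine ⟨FDRep.of σ, simple_of_isIrreducible_s4 σ, fun h ↦ hv ?_, fun g hg ↦ ?_⟩
  · exact (Representation.ofModule'_apply S z v).symm.trans (LinearMap.congr_fun h v)
  · refine LinearMap.ext fun (x : S) ↦ ?_
    refine (Representation.ofModule'_apply S g x).trans (Subtype.ext ?_)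
    change MonoidAlgebra.of ℂ G g • (x : ρ.asModule) = x
    refine (Representation.asModuleEquiv_symm_map_rho ρ g (ρ.asModuleEquiv x)).symm.trans ?_
    rw [hg]
    rfl

theorem charKer_eq_ker [Finite G] (V : FDRep ℂ G) : charKer V = (V.ρ.ker : Set G) := by
  ext g
  change V.character g = V.character 1 ↔ V.ρ g = 1
  constructor
  · intro h
    rw [char_one] at h
    refine Module.End.eq_one_of_pow_eq_one_of_trace_eq_finrank (V.ρ g) (orderOf_pos g).ne' ?_ h
    rw [← map_pow, pow_orderOf_eq_one, map_one]
  · intro h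
    rw [character, character, h, map_one V.ρ]

theorem ρ_commutator_eq_one (V : FDRep ℂ G) (h : Module.finrank ℂ V ≤ 1) (a b : G) :
    V.ρ ⁅a, b⁆ = 1 := by
  have hcomm : ∀ f f' : Module.End ℂ V, f * f' = f' * f := by
    intro f f'
    obtain ⟨v, hv⟩ := finrank_le_one_iff.1 h
    obtain ⟨c, hc⟩ := hv (f v)
    have : f = c • 1 := by
      ext w
      obtain ⟨d, rfl⟩ := hv w
      simp [← hc]
    rw [this]
    simp
  rw [commutatorElement_def, map_mul, map_mul, map_mul, hcomm (V.ρ a), mul_assoc (V.ρ b),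
    ← map_mul, mul_inv_cancel, map_one, mul_one, ← map_mul, mul_inv_cancel, map_one]

theorem exists_nonlinear_of_commutator_notMem [Finite G] (M : Subgroup G) [M.Normal] (a b : G)
    (hab : ⁅a, b⁆ ∉ M) :
    ∃ U : FDRep ℂ G, Simple U ∧ 1 < Module.finrank ℂ U ∧ M ≤ U.ρ.ker := by
  have hne : Representation.ofMulAction ℂ G (G ⧸ M) ⁅a, b⁆ ≠ 1 := by
    intro h
    have h1 := LinearMap.congr_fun h (MonoidAlgebra.single ((1 : G) : G ⧸ M) 1)
    rw [Representation.ofMulAction_single] at h1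
    have h2 : ((⁅a, b⁆ * 1 : G) : G ⧸ M) = (1 : G) :=
      MonoidAlgebra.single_left_injective one_ne_zero h1
    rw [mul_one, QuotientGroup.mk_one, QuotientGroup.eq_one_iff] at h2
    exact hab h2
  obtain ⟨U, hU, hz, hker⟩ := exists_simple_ρ_ne_one _ _ hne
  refine ⟨U, hU, ?_, fun g hg ↦ hker g ?_⟩
  · by_contra! hle
    exact hz (ρ_commutator_eq_one U hle a b)
  · refine MonoidAlgebra.lhom_ext' fun x ↦ LinearMap.ext fun c ↦ ?_
    change Representation.ofMulAction ℂ G (G ⧸ M) g (MonoidAlgebra.single x c) =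
      MonoidAlgebra.single x c
    rw [Representation.ofMulAction_single]
    congr 1
    induction x using QuotientGroup.induction_on with
    | H x =>
      change ((g * x : G) : G ⧸ M) = x
      rw [QuotientGroup.mk_mul, (QuotientGroup.eq_one_iff g).2 hg, one_mul]

/-- If every commutator of `G` acts as a central operator, the degree of a simple representation
is determined by its center. -/
theorem finrank_sq_mul_card_charCenter [Finite G] (V : FDRep ℂ G) [Simple V]
    (hcent : ∀ a b x : G, V.ρ ⁅a, b⁆ * V.ρ x = V.ρ x * V.ρ ⁅a, b⁆) :
    Module.finrank ℂ V ^ 2 * Nat.card (charCenter V) = Nat.card G := by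
  classical
  have := Fintype.ofFinite G
  have hsum := (simple_iff_char_is_norm_one V).1 inferInstance
  have hpos : Module.finrank ℂ V ≠ 0 := by
    intro h0
    have hz : ∀ g, V.character g = 0 := fun g ↦ by
      have := Module.finrank_zero_iff.1 h0
      rw [character, Subsingleton.elim (V.ρ g) 0, map_zero]
    simp [hz, eq_comm] at hsum
  have hterm : ∀ g, V.character g * V.character g⁻¹ =
      if g ∈ charCenter V then (Module.finrank ℂ V : ℂ) ^ 2 else 0 := by
    intro g
    by_cases hg : ∀ x, V.ρ x ∘ₗ V.ρ g = V.ρ g ∘ₗ V.ρ x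
    · obtain ⟨c, hc⟩ := eq_smul_one_of_forall_commute V (V.ρ g) hg
      obtain ⟨d, hd⟩ := eq_smul_one_of_forall_commute V (V.ρ g⁻¹) fun x ↦ by
        have hx := congrArg (fun f ↦ V.ρ g⁻¹ ∘ₗ f ∘ₗ V.ρ g⁻¹) (hg x)
        change V.ρ g⁻¹ * ((V.ρ x * V.ρ g) * V.ρ g⁻¹) = V.ρ g⁻¹ * ((V.ρ g * V.ρ x) * V.ρ g⁻¹) at hx
        simp only [← map_mul] at hx
        change V.ρ x * V.ρ g⁻¹ = V.ρ g⁻¹ * V.ρ x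
        simp only [← map_mul]
        simpa [mul_assoc] using hx.symm
      have : Nontrivial V := Module.nontrivial_of_finrank_pos (Nat.pos_of_ne_zero hpos)
      obtain ⟨v, hv⟩ := exists_ne (0 : V)
      have hpow : c ^ orderOf g = 1 := by
        have h1 : V.ρ g ^ orderOf g = 1 := by rw [← map_pow, pow_orderOf_eq_one, map_one]
        rw [hc] at h1
        change (c • (1 : Module.End ℂ V)) ^ orderOf g = 1 at h1
        rw [smul_pow, one_pow] at h1
        have h2 := LinearMap.congr_fun h1 v
        exact smul_left_injective ℂ hv (by simpa using h2)
      have hcd : c * d = 1 := by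
        have h1 : V.ρ g * V.ρ g⁻¹ = 1 := by rw [← map_mul, mul_inv_cancel, map_one]
        rw [hc, hd] at h1
        have h2 := LinearMap.congr_fun h1 v
        exact smul_left_injective ℂ hv (by simpa [mul_smul, smul_comm d c] using h2)
      have hχ : V.character g = c * Module.finrank ℂ V := by
        rw [character, hc, map_smul, LinearMap.trace_id, smul_eq_mul]
      have hχ' : V.character g⁻¹ = d * Module.finrank ℂ V := by
        rw [character, hd, map_smul, LinearMap.trace_id, smul_eq_mul]
      have hmem : g ∈ charCenter V := by
        change ((‖V.character g‖ : ℝ) : ℂ) = V.character 1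
        rw [hχ, norm_mul, Complex.norm_eq_one_of_pow_eq_one hpow (orderOf_pos g).ne', char_one]
        simp
      rw [if_pos hmem, hχ, hχ']
      linear_combination (Module.finrank ℂ V : ℂ) ^ 2 * hcd
    · push Not at hg
      obtain ⟨x, hx⟩ := hg
      obtain ⟨c, hc⟩ := eq_smul_one_of_forall_commute V (V.ρ ⁅x, g⁆) fun y ↦ (hcent x g y).symm
      have hconj : V.ρ (x * g * x⁻¹) = c • V.ρ g := by
        have : x * g * x⁻¹ = ⁅x, g⁆ * g := by rw [commutatorElement_def]; group
        rw [this, map_mul, hc]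
        rfl
      have hc1 : c ≠ 1 := by
        rintro rfl
        apply hx
        change V.ρ x * V.ρ g = V.ρ g * V.ρ x
        rw [one_smul] at hconj
        nth_rw 2 [← hconj]
        rw [← map_mul, ← map_mul, inv_mul_cancel_right]
      have hχ : V.character g = 0 := by
        have h1 := V.char_conj g x
        rw [character, hconj, map_smul, smul_eq_mul] at h1
        change c * V.character g = V.character g at h1
        have h2 : (c - 1) * V.character g = 0 := by rw [sub_mul, h1, one_mul, sub_self]
        exact (mul_eq_zero.1 h2).resolve_left (sub_ne_zero.2 hc1)
      have hmem : g ∉ charCenter V := by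
        intro h
        change ((‖V.character g‖ : ℝ) : ℂ) = V.character 1 at h
        rw [hχ, char_one, norm_zero, Complex.ofReal_zero] at h
        exact hpos (by exact_mod_cast h.symm)
      rw [if_neg hmem, hχ, zero_mul]
  simp only [hterm] at hsum
  rw [← Finset.sum_filter, Finset.sum_const, nsmul_eq_mul] at hsum
  have hcard : Nat.card (charCenter V) = (Finset.univ.filter (· ∈ charCenter V)).card := by
    rw [Nat.card_eq_fintype_card, Fintype.card_subtype]
  rw [hcard, mul_comm]
  exact_mod_cast hsum

end FDRep

/-- If `m` is the largest non-negative integer such that some non-linear irreducible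
complex character of the non-Abelian finite `p`-group `G` (`p` odd) has kernel of order
`p ^ m`, and `χ` is a non-linear irreducible character with `|ker χ| = p ^ m`, then
`χ(1)² = |G| / |Z(χ)|`. -/
theorem degree_sq_eq_index_center (p m : ℕ) (hp : p.Prime) (hodd : Odd p)
    (G : Type) [Group G] [Fintype G] (hpG : IsPGroup p G)
    (hnab : ¬ ∀ a b : G, a * b = b * a)
    (hmax : ∀ k : ℕ, (∃ V : FDRep ℂ G, Simple V ∧ 1 < Module.finrank ℂ V ∧
      Nat.card (charKer V) = p ^ k) → k ≤ m)
    (V : FDRep ℂ G) (hV : Simple V) (hnl : 1 < Module.finrank ℂ V)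
    (hker : Nat.card (charKer V) = p ^ m) :
    Module.finrank ℂ V ^ 2 * Nat.card (charCenter V) = Nat.card G := by
  refine FDRep.finrank_sq_mul_card_charCenter V fun a b x ↦ ?_
  have hkerV : Nat.card V.ρ.ker = p ^ m := by rwa [FDRep.charKer_eq_ker] at hker
  let M : Subgroup G := (Subgroup.center (G ⧸ V.ρ.ker)).comap (QuotientGroup.mk' V.ρ.ker)
  suffices hM : ⁅a, b⁆ ∈ M by
    have h1 := Subgroup.mem_center_iff.1 (Subgroup.mem_comap.1 hM) (x : G ⧸ V.ρ.ker)
    change ((x * ⁅a, b⁆ : G) : G ⧸ V.ρ.ker) = ((⁅a, b⁆ * x : G) : G ⧸ V.ρ.ker) at h1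
    rw [QuotientGroup.eq, MonoidHom.mem_ker] at h1
    have h2 : V.ρ (x * ⁅a, b⁆) * V.ρ ((x * ⁅a, b⁆)⁻¹ * (⁅a, b⁆ * x)) = V.ρ (⁅a, b⁆ * x) := by
      rw [← map_mul, mul_inv_cancel_left]
    rw [h1, mul_one, map_mul, map_mul] at h2
    exact h2.symm
  by_contra hM
  have hle : V.ρ.ker ≤ M := by
    intro g hg
    change ((g : G) : G ⧸ V.ρ.ker) ∈ Subgroup.center _
    rw [(QuotientGroup.eq_one_iff g).2 hg]
    exact one_mem _
  have hlt : V.ρ.ker < M := by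
    refine lt_of_le_of_ne hle fun heq ↦ ?_
    have : Fact p.Prime := ⟨hp⟩
    have : Nontrivial (G ⧸ V.ρ.ker) :=
      ⟨(⁅a, b⁆ : G), 1, fun h ↦ hM (hle ((QuotientGroup.eq_one_iff _).1 h))⟩
    have : Nontrivial (Subgroup.center (G ⧸ V.ρ.ker)) :=
      (hpG.to_quotient V.ρ.ker).center_nontrivial
    obtain ⟨⟨y, hy⟩, hy1⟩ := exists_ne (1 : Subgroup.center (G ⧸ V.ρ.ker))
    obtain ⟨g, rfl⟩ := QuotientGroup.mk_surjective y
    have hg : g ∈ V.ρ.ker := by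
      rw [heq]
      exact hy
    exact hy1 (Subtype.ext ((QuotientGroup.eq_one_iff g).2 hg))
  obtain ⟨U, hU, hUnl, hUker⟩ := FDRep.exists_nonlinear_of_commutator_notMem M a b hM
  have : Fact p.Prime := ⟨hp⟩
  obtain ⟨k, hk⟩ := IsPGroup.iff_card.1 (hpG.to_subgroup U.ρ.ker)
  have hkm : k ≤ m := hmax k ⟨U, hU, hUnl, by rw [FDRep.charKer_eq_ker]; exact hk⟩
  have hcard : Nat.card V.ρ.ker < Nat.card U.ρ.ker :=
    Set.ncard_lt_ncard (hlt.trans_le hUker) (Set.toFinite _)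
  rw [hkerV, hk] at hcard
  exact hcard.not_ge (Nat.pow_le_pow_right hp.pos hkm)
end

section
/- Let p be an odd prime and let G be a finite p-group with |G'| = p such that every non-linear irreducible complex character of G has kernel of order exactly p^m for a fixed integer m ≥ 0. Then |Z(G)| / exp(Z(G)) = p^m, where exp(Z(G)) is the exponent of the center of G. -/
open CategoryTheory

open MonoidAlgebra in
/-- For a linear character `l` of the center, the left ideal of the elements of the group algebra
on which the center acts through `l`. -/
noncomputable def centralEigenspace {k G : Type} [Field k] [Group G]
    (l : Subgroup.center G →* kˣ) : Submodule k[G] k[G] where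
  carrier := {a | ∀ z : Subgroup.center G, single (z : G) (1 : k) * a = (l z : k) • a}
  zero_mem' := by simp
  add_mem' ha hb z := by rw [mul_add, ha, hb, smul_add]
  smul_mem' c a ha z := by
    have hz : Commute (single (z : G) (1 : k)) c :=
      single_commute (fun g ↦ ((Subgroup.mem_center_iff.1 z.2) g).symm) (fun r ↦ .one_left r) c
    rw [smul_eq_mul, ← mul_assoc, hz.eq, mul_assoc, ha z, mul_smul_comm]

open MonoidAlgebra in
lemma centralEigenspace_ne_bot {k G : Type} [Field k] [Group G] [Finite G]
    (l : Subgroup.center G →* kˣ) : centralEigenspace l ≠ ⊥ := by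
  classical
  have := Fintype.ofFinite (Subgroup.center G)
  let e : k[G] := ∑ z : Subgroup.center G, single (z : G) ((l z)⁻¹ : k)
  have he : e ∈ centralEigenspace l := by
    intro y
    simp only [e, Finset.mul_sum, Finset.smul_sum, single_mul_single, one_mul]
    refine Fintype.sum_equiv (Equiv.mulLeft y) _ _ fun z ↦ ?_
    simp [mul_inv_rev, mul_comm]
  have h1 : e.coeff 1 = 1 := by
    have : e.coeff 1 = ∑ z : Subgroup.center G, if z = 1 then (1 : k) else 0 := by
      simp only [e, coeff_sum, Finsupp.finsetSum_apply]
      refine Finset.sum_congr rfl fun z _ ↦ ?_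
      by_cases hz : z = 1
      · subst hz; simp
      · simp [hz]
    simp [this]
  intro h
  rw [h, Submodule.mem_bot] at he
  simp [he] at h1

/-- A finite group has a simple complex representation with any prescribed central character. -/
lemma exists_simple_fdRep_center_smul {G : Type} [Group G] [Finite G]
    (l : Subgroup.center G →* ℂˣ) :
    ∃ V : FDRep ℂ G, Simple V ∧
      ∀ z : Subgroup.center G, V.ρ (z : G) = (l z : ℂ) • LinearMap.id := by
  obtain ⟨S, hS, hsimple⟩ := (IsSemisimpleModule.eq_bot_or_exists_simple_le
    (centralEigenspace l)).resolve_left (centralEigenspace_ne_bot l)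
  have hfin : Module.Finite ℂ (MonoidAlgebra ℂ G) :=
    .equiv (MonoidAlgebra.coeffLinearEquiv ℂ).symm
  have hfinS : Module.Finite ℂ S := inferInstanceAs (Module.Finite ℂ (S.restrictScalars ℂ))
  let r : Representation ℂ G S := Representation.ofModule' S
  have hr : r.IsIrreducible := by
    rw [Representation.irreducible_iff_isSimpleModule_asModule]
    have hr' : r.asAlgebraHom = Algebra.lsmul ℂ ℂ S :=
      (MonoidAlgebra.lift ℂ (Module.End ℂ S) G).apply_symm_apply _
    let e : r.asModule ≃ₗ[MonoidAlgebra ℂ G] S :=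
      { r.asModuleEquiv with
        map_smul' := fun a v ↦ LinearMap.congr_fun (DFunLike.congr_fun hr' a) (r.asModuleEquiv v) }
    exact IsSimpleModule.congr e
  refine ⟨FDRep.of r, ?_, fun z ↦ ?_⟩
  · rw [FDRep.simple_iff_end_is_rank_one,
      ← (FDRep.forget₂HomLinearEquiv _ _).finrank_eq, (Rep.homLinearEquiv _ _).finrank_eq]
    exact Representation.IsIrreducible.finrank_intertwiningMap_self r
  · exact LinearMap.ext fun v ↦ Subtype.ext (hS v.2 z)

/-- In a `p`-group, a normal subgroup of order `p` is central. -/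
lemma IsPGroup.le_center_of_card_eq_prime {p : ℕ} [Fact p.Prime] {G : Type*} [Group G] [Finite G]
    (hG : IsPGroup p G) (N : Subgroup G) [N.Normal] (hN : Nat.card N = p) :
    N ≤ Subgroup.center G := by
  have hG' : IsPGroup p (ConjAct G) := hG
  obtain ⟨b, hb, hb1⟩ := hG'.exists_fixed_point_of_prime_dvd_card_of_fixed_point N
    (dvd_of_eq hN.symm) (a := 1) (fun g ↦ smul_one g)
  have hbz : (b : G) ∈ Subgroup.center G := by
    rw [Subgroup.mem_center_iff]
    intro g
    have := congrArg Subtype.val (hb (ConjAct.toConjAct g))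
    rw [ConjAct.Subgroup.val_conj_smul, ConjAct.toConjAct_smul] at this
    exact mul_inv_eq_iff_eq_mul.1 this
  intro c hc
  obtain ⟨n, hn⟩ := mem_zpowers_of_prime_card hN (g := b) (g' := ⟨c, hc⟩) hb1.symm
  have : c = (b : G) ^ n := by simpa using (congrArg Subtype.val hn).symm
  exact this ▸ zpow_mem hbz n

open scoped commutatorElement in
/-- If the derived subgroup is central and the central character `l` of `V` is injective on it,
then the character of `V` vanishes off the center. -/
lemma character_eq_zero_of_notMem_center {G : Type} [Group G] (V : FDRep ℂ G)
    (l : Subgroup.center G →* ℂˣ)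
    (hl : ∀ z : Subgroup.center G, V.ρ (z : G) = (l z : ℂ) • LinearMap.id)
    (hc : commutator G ≤ Subgroup.center G)
    (hinj : ∀ z : Subgroup.center G, (z : G) ∈ commutator G → l z = 1 → z = 1)
    {g : G} (hg : g ∉ Subgroup.center G) : V.character g = 0 := by
  obtain ⟨h, hh⟩ : ∃ h, h * g ≠ g * h := by
    simpa [Subgroup.mem_center_iff] using hg
  have hmem : ⁅h, g⁆ ∈ commutator G :=
    Subgroup.commutator_mem_commutator (Subgroup.mem_top h) (Subgroup.mem_top g)
  let z : Subgroup.center G := ⟨⁅h, g⁆, hc hmem⟩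
  have hlz : (l z : ℂ) ≠ 1 := fun h1 ↦ hh <| commutatorElement_eq_one_iff_mul_comm.1 <|
    congrArg Subtype.val (hinj z hmem (Units.ext h1))
  have hconj : V.character (h * g * h⁻¹) = (l z : ℂ) * V.character g := by
    have : h * g * h⁻¹ = (z : G) * g := by simp [z, commutatorElement_def]
    rw [this, FDRep.character, map_mul, hl z, FDRep.character]
    simp [← Module.End.one_eq_id]
  rw [FDRep.char_conj] at hconj
  have : ((l z : ℂ) - 1) * V.character g = 0 := by rw [sub_mul, one_mul, ← hconj, sub_self]
  exact (mul_eq_zero.1 this).resolve_left (sub_ne_zero.2 hlz)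

/-- A finite abelian `p`-group has a linear character of maximal order that is nontrivial on a
given nontrivial element. -/
lemma exists_monoidHom_orderOf_eq_exponent_apply_ne_one {p : ℕ} [Fact p.Prime] {A : Type*}
    [Group A] [IsMulCommutative A] [Finite A] (hA : IsPGroup p A) {a : A} (ha : a ≠ 1) :
    ∃ l : A →* ℂˣ, orderOf l = Monoid.exponent A ∧ l a ≠ 1 := by
  let _ : CommGroup A := { ‹Group A› with mul_comm := mul_comm' }
  obtain ⟨e⟩ := CommGroup.monoidHom_mulEquiv_of_hasEnoughRootsOfUnity A ℂ
  have : Finite (A →* ℂˣ) := Finite.of_equiv _ e.symm.toEquiv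
  have hD : IsPGroup p (A →* ℂˣ) := hA.of_equiv e.symm
  have hexp : Monoid.exponent (A →* ℂˣ) = Monoid.exponent A := Monoid.exponent_eq_of_mulEquiv e
  obtain ⟨l, hl⟩ := Monoid.exists_orderOf_eq_exponent
    (Monoid.ExponentExists.of_finite (G := A →* ℂˣ))
  by_cases hla : l a = 1
  swap
  · exact ⟨l, hl.trans hexp, hla⟩
  obtain ⟨m, hm⟩ := CommGroup.exists_apply_ne_one_of_hasEnoughRootsOfUnity A ℂ ha
  by_cases hmo : orderOf m = orderOf l
  · exact ⟨m, (hmo.trans hl).trans hexp, hm⟩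
  refine ⟨m * l, ?_, by simpa [hla] using hm⟩
  rw [← hexp, ← hl]
  refine (Commute.all m l).orderOf_mul_eq_right_of_forall_prime_mul_dvd (isOfFinOrder_of_finite l)
    fun q hq hqm ↦ ?_
  obtain ⟨i, hi⟩ := IsPGroup.iff_orderOf.1 hD m
  obtain ⟨j, hj⟩ := IsPGroup.iff_orderOf.1 hD l
  have hp : p.Prime := Fact.out
  have hqp : q = p := (Nat.prime_dvd_prime_iff_eq hq hp).1 (hq.dvd_of_dvd_pow (hi ▸ hqm))
  have hdvd : p ^ i ∣ p ^ j := by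
    rw [← hi, ← hj, hl]; exact Monoid.order_dvd_exponent m
  rw [hi, hj] at hmo ⊢
  have hij := (Nat.pow_dvd_pow_iff_le_right hp.one_lt).1 hdvd
  have : i ≠ j := fun h ↦ hmo (h ▸ rfl)
  rw [hqp, ← pow_succ']
  exact pow_dvd_pow p (by omega)

lemma card_eq_card_ker_mul_orderOf {A K : Type*} [Group A] [Finite A] [Field K] (l : A →* Kˣ) :
    Nat.card A = Nat.card l.ker * orderOf l := by
  have : Finite l.range := Finite.of_surjective _ l.rangeRestrict_surjective
  have hcyc : IsCyclic l.range := inferInstance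
  have ho : orderOf l = Nat.card l.range := by
    rw [← IsCyclic.exponent_eq_card]
    refine Nat.dvd_antisymm (orderOf_dvd_of_pow_eq_one ?_) ?_
    · ext x
      have := congrArg Subtype.val (Monoid.pow_exponent_eq_one (l.rangeRestrict x))
      simpa using congrArg Units.val this
    · refine Monoid.exponent_dvd_of_forall_pow_eq_one ?_
      rintro ⟨_, x, rfl⟩
      ext1
      exact DFunLike.congr_fun (pow_orderOf_eq_one l) x
  rw [ho, ← Subgroup.index_ker, Subgroup.card_mul_index]

/-- Let `p` be an odd prime and `G` a finite `p`-group with `|G'| = p` such that every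
non-linear irreducible complex character of `G` has kernel of order exactly `p ^ m`
(`m ≥ 0`). Then `|Z(G)| / exp(Z(G)) = p ^ m`. -/
theorem center_card_div_exponent (p m : ℕ) (hp : p.Prime) (hodd : Odd p)
    (G : Type) [Group G] [Fintype G] (hpG : IsPGroup p G)
    (hG' : Nat.card (commutator G) = p)
    (hker : ∀ V : FDRep ℂ G, Simple V → 1 < Module.finrank ℂ V →
      Nat.card (charKer V) = p ^ m) :
    Nat.card (Subgroup.center G) =
      p ^ m * Monoid.exponent ↥(Subgroup.center G) := by
  have : Fact p.Prime := ⟨hp⟩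
  have hc : commutator G ≤ Subgroup.center G := hpG.le_center_of_card_eq_prime _ hG'
  have hnt : Nontrivial (commutator G) := Finite.one_lt_card_iff_nontrivial.1 (hG' ▸ hp.one_lt)
  obtain ⟨a, ha⟩ := exists_ne (1 : commutator G)
  have ha' : (⟨a, hc a.2⟩ : Subgroup.center G) ≠ 1 := fun h ↦
    ha (Subtype.ext (congrArg (fun x : Subgroup.center G ↦ (x : G)) h))
  obtain ⟨l, hlo, hla⟩ := exists_monoidHom_orderOf_eq_exponent_apply_ne_one
    (A := Subgroup.center G) (hpG.to_subgroup (Subgroup.center G)) ha'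
  have hinj (z : Subgroup.center G) (hz : (z : G) ∈ commutator G) (hlz : l z = 1) : z = 1 := by
    by_contra hz1
    obtain ⟨n, hn⟩ := mem_zpowers_of_prime_card hG' (g := ⟨z, hz⟩) (g' := a)
      fun h ↦ hz1 (Subtype.ext (congrArg (fun x : commutator G ↦ (x : G)) h))
    apply hla
    have : (⟨a, hc a.2⟩ : Subgroup.center G) = z ^ n :=
      Subtype.ext (by simpa using (congrArg Subtype.val hn).symm)
    rw [this, map_zpow, hlz, one_zpow]
  obtain ⟨V, hV, hVl⟩ := exists_simple_fdRep_center_smul l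
  have hzero {g : G} (hg : g ∉ Subgroup.center G) : V.character g = 0 :=
    character_eq_zero_of_notMem_center V l hVl hc hinj hg
  have hdim0 : Module.finrank ℂ V ≠ 0 := by
    intro h0
    have hsub : Subsingleton V := Module.finrank_zero_iff.1 h0
    have := (FDRep.simple_iff_end_is_rank_one V).1 hV
    have hsub' : Subsingleton (V ⟶ V) := ⟨fun f g ↦ by
      ext x; exact Subsingleton.elim _ _⟩
    rw [Module.finrank_zero_of_subsingleton] at this
    exact zero_ne_one this
  have hdim1 : Module.finrank ℂ V ≠ 1 := by
    intro h1
    obtain ⟨g, hg⟩ : ∃ g, g ∉ Subgroup.center G := by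
      by_contra! hall
      apply ha
      have htop : Subgroup.center G = ⊤ := top_unique fun g _ ↦ hall g
      have : commutator G = ⊥ := by
        rw [commutator_def, Subgroup.commutator_top_right_eq_bot_iff_le_center, htop]
      exact Subtype.ext (by simpa [this] using a.2)
    obtain ⟨c, hcg, -⟩ := LinearMap.existsUnique_eq_smul_id_of_finrank_eq_one h1 (V.ρ g)
    have htr := hzero hg
    rw [FDRep.character, hcg, map_smul, ← Module.End.one_eq_id, LinearMap.trace_one, h1] at htr
    have hc0 : c = 0 := by simpa using htr
    have hinv : V.ρ g * V.ρ g⁻¹ = 1 := by rw [← map_mul, mul_inv_cancel, map_one]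
    rw [hcg, hc0, zero_smul, zero_mul] at hinv
    have := congrArg (LinearMap.trace ℂ V) hinv
    rw [LinearMap.trace_one, h1] at this
    simp at this
  have hker_eq : charKer V = ((l.ker.map (Subgroup.center G).subtype : Subgroup G) : Set G) := by
    have hdim : (Module.finrank ℂ V : ℂ) ≠ 0 := Nat.cast_ne_zero.2 hdim0
    ext g
    simp only [charKer, Set.mem_ofPred_eq, FDRep.char_one, SetLike.mem_coe, Subgroup.mem_map,
      MonoidHom.mem_ker]
    by_cases hg : g ∈ Subgroup.center G
    · have hchar : V.character g = (l ⟨g, hg⟩ : ℂ) * Module.finrank ℂ V := by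
        rw [FDRep.character, hVl ⟨g, hg⟩, map_smul, ← Module.End.one_eq_id, LinearMap.trace_one,
          smul_eq_mul]
      rw [hchar, mul_eq_right₀ hdim, Units.val_eq_one]
      exact ⟨fun h ↦ ⟨⟨g, hg⟩, h, rfl⟩, fun ⟨x, hx, hxg⟩ ↦ by subst hxg; exact hx⟩
    · rw [hzero hg]
      exact ⟨fun h ↦ absurd h.symm hdim, fun ⟨x, _, hxg⟩ ↦ absurd (hxg ▸ x.2) hg⟩
  have hcard := hker V hV (by omega)
  rw [hker_eq] at hcard
  have hcard' : Nat.card l.ker = p ^ m := by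
    rw [← hcard]
    exact (Subgroup.card_map_of_injective (Subgroup.center G).subtype_injective).symm
  rw [← hcard', ← hlo]
  exact card_eq_card_ker_mul_orderOf l
end
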